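/- Let p > 1 and α > 2 be real numbers. Let b₀, c₀ > 0 be real numbers with 4(p+1)·b₀ ≤ α(α−2)·c₀. Let a, b, c be real numbers with a ≥ 0, 0 ≤ b ≤ b₀, c ≥ c₀, and suppose P := a/2 − b/2 − α c/(2(p+1)) ≤ 0. Set λ₀ = (c₀/c)^{1/α}. Then λ₀²·a/2 + λ₀⁻²·b/2 − λ₀^α·c/(p+1) ≤ (a/2 + b/2 − c/(p+1)) − P; that is, the scaled energy e(λ₀) satisfies e(λ₀) ≤ E − P. -/

import Mathlib

/-- A Bernoulli-type bound, equivalent to `1 + γ (1 - x) ≤ x ^ (-γ)`. -/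
theorem rpow_mul_one_add_mul_one_sub_le_one {x γ : ℝ} (hx : 0 < x) (hγ : 0 ≤ γ) (hx1 : x ≤ 1) :
    x ^ γ * (1 + γ * (1 - x)) ≤ 1 := by
  have h1 : x ^ γ ≤ Real.exp (γ * (x - 1)) := by
    rw [Real.rpow_def_of_pos hx, Real.exp_le_exp, mul_comm]
    exact mul_le_mul_of_nonneg_left (Real.log_le_sub_one_of_pos hx) hγ
  have h2 : 1 + γ * (1 - x) ≤ Real.exp (γ * (1 - x)) := by
    linarith [Real.add_one_le_exp (γ * (1 - x))]
  have h3 : 0 ≤ 1 + γ * (1 - x) := by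
    have := mul_nonneg hγ (sub_nonneg.2 hx1)
    linarith
  calc x ^ γ * (1 + γ * (1 - x))
      ≤ Real.exp (γ * (x - 1)) * Real.exp (γ * (1 - x)) :=
        mul_le_mul h1 h2 h3 (Real.exp_pos _).le
    _ = 1 := by rw [← Real.exp_add]; ring_nf; exact Real.exp_zero

/-- A second-order lower bound for the Taylor remainder of `s ↦ s ^ (γ + 1)` at `1`. -/
theorem second_order_le_taylor_remainder_rpow {s γ : ℝ} (hs : 0 < s) (hs1 : s ≤ 1) (hγ : 0 ≤ γ) :
    (γ + 1) * γ / 2 * s ^ γ * (1 - s) ^ 2 ≤ s * s ^ γ - 1 - (γ + 1) * (s - 1) := by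
  let g : ℝ → ℝ := fun x =>
    x * x ^ γ - 1 - (γ + 1) * (x - 1) - (γ + 1) * γ / 2 * (x ^ γ * (1 - x) ^ 2)
  have hd : ∀ x, 0 < x → HasDerivAt g
      ((γ + 1) * (x ^ γ * (1 + γ * (1 - x)) - 1 - γ ^ 2 / 2 * x ^ (γ - 1) * (1 - x) ^ 2)) x := by
    intro x hx
    have hr : HasDerivAt (fun y : ℝ => y ^ γ) (γ * x ^ (γ - 1)) x :=
      Real.hasDerivAt_rpow_const (Or.inl hx.ne')
    have hi := hasDerivAt_id' x
    have hx' : x ^ γ = x * x ^ (γ - 1) := by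
      rw [Real.rpow_sub_one hx.ne']; field_simp
    have hg := (((hi.mul hr).sub_const 1).sub ((hi.sub_const 1).const_mul (γ + 1))).sub
      ((hr.mul ((hi.const_sub 1).pow 2)).const_mul ((γ + 1) * γ / 2))
    refine hg.congr_deriv ?_
    simp only [hx', Pi.pow_apply, Nat.cast_ofNat]
    ring
  have hanti : AntitoneOn g (Set.Icc s 1) := by
    apply antitoneOn_of_deriv_nonpos (convex_Icc s 1)
    · exact fun x hx => (hd x (hs.trans_le hx.1)).continuousAt.continuousWithinAt
    · rw [interior_Icc]
      exact fun x hx => (hd x (hs.trans hx.1)).differentiableAt.differentiableWithinAt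
    · rw [interior_Icc]
      intro x hx
      have hx0 := hs.trans hx.1
      rw [(hd x hx0).deriv]
      have h1 := rpow_mul_one_add_mul_one_sub_le_one hx0 hγ hx.2.le
      have h2 : 0 ≤ γ ^ 2 / 2 * x ^ (γ - 1) * (1 - x) ^ 2 := by positivity
      exact mul_nonpos_of_nonneg_of_nonpos (by linarith) (by linarith)
  have h := hanti ⟨le_rfl, hs1⟩ ⟨hs1, le_rfl⟩ hs1
  simp only [g, Real.one_rpow] at h
  linarith

/-- with `4(p+1)b₀ ≤ α(α−2)c₀`, `a ≥ 0`, `0 ≤ b ≤ b₀`, `c ≥ c₀`,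
`P = a/2 − b/2 − αc/(2(p+1)) ≤ 0` and `λ₀ = (c₀/c)^{1/α}`, the scaled energy
satisfies `e(λ₀) ≤ E − P`. -/
theorem stmt9 (p α b₀ c₀ a b c lam₀ : ℝ) (hp : 1 < p) (hα : 2 < α)
    (hb₀ : 0 < b₀) (hc₀ : 0 < c₀)
    (hkey : 4 * (p + 1) * b₀ ≤ α * (α - 2) * c₀)
    (ha : 0 ≤ a) (hb : 0 ≤ b) (hbb₀ : b ≤ b₀) (hc : c₀ ≤ c)
    (hP : a / 2 - b / 2 - α * c / (2 * (p + 1)) ≤ 0)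
    (hlam₀ : lam₀ = (c₀ / c) ^ (1 / α)) :
    lam₀ ^ 2 * a / 2 + (lam₀ ^ 2)⁻¹ * b / 2 - lam₀ ^ α * c / (p + 1)
      ≤ (a / 2 + b / 2 - c / (p + 1))
        - (a / 2 - b / 2 - α * c / (2 * (p + 1))) := by
  have hc' : 0 < c := hc₀.trans_le hc
  have hl : 0 < lam₀ := hlam₀ ▸ Real.rpow_pos_of_pos (div_pos hc₀ hc') _
  have hl1 : lam₀ ≤ 1 := hlam₀ ▸ Real.rpow_le_one (div_pos hc₀ hc').le
    ((div_le_one hc').2 hc) (by positivity)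
  have hpow : lam₀ ^ α = c₀ / c := by
    rw [hlam₀, ← Real.rpow_mul (div_pos hc₀ hc').le, one_div_mul_cancel (by linarith),
      Real.rpow_one]
  obtain ⟨s, hs⟩ : ∃ s, s = lam₀ ^ 2 := ⟨_, rfl⟩
  have hs0 : 0 < s := by rw [hs]; positivity
  have hs1 : s ≤ 1 := hs ▸ pow_le_one₀ hl.le hl1
  have hsγ : s ^ (α / 2 - 1) = c₀ / c / s := by
    rw [Real.rpow_sub_one hs0.ne', ← hpow, hs, ← Real.rpow_natCast lam₀ 2,
      ← Real.rpow_mul hl.le]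
    congr 2
    push_cast
    ring
  have hT := second_order_le_taylor_remainder_rpow hs0 hs1 (γ := α / 2 - 1) (by linarith)
  rw [hsγ] at hT
  rw [hpow, ← hs]
  have hp1 : 0 < p + 1 := by linarith
  have hb' : b ≤ α * (α - 2) * c₀ / (4 * (p + 1)) := by
    rw [le_div_iff₀ (by positivity)]
    nlinarith
  have hw : 0 ≤ (1 - s) ^ 2 / (2 * s) := by positivity
  have hbw := mul_le_mul_of_nonneg_right hb' hw
  have hTw := mul_le_mul_of_nonneg_left hT (div_pos hc' hp1).le
  have hPs := mul_nonpos_of_nonneg_of_nonpos hs0.le hP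
  have e1 : α * (α - 2) * c₀ / (4 * (p + 1)) * ((1 - s) ^ 2 / (2 * s)) =
      c / (p + 1) * ((α / 2 - 1 + 1) * (α / 2 - 1) / 2 * (c₀ / c / s) * (1 - s) ^ 2) := by
    field_simp
    ring
  have e2 : (a / 2 + b / 2 - c / (p + 1)) - (a / 2 - b / 2 - α * c / (2 * (p + 1)))
      - (s * a / 2 + s⁻¹ * b / 2 - c₀ / c * c / (p + 1)) =
      c / (p + 1) * (s * (c₀ / c / s) - 1 - (α / 2 - 1 + 1) * (s - 1))
      - b * ((1 - s) ^ 2 / (2 * s)) - s * (a / 2 - b / 2 - α * c / (2 * (p + 1))) := by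
    field_simp
    ring
  linarith
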